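/- arXiv:2309.06015 — 4 statements merged into one kernel-verified Lean document; each statement's English description precedes it below -/
import Mathlib

section
/- Let d ≥ 2 and let 𝓕 be an affine invariant family of globally Lipschitz functions from ℝ^d to ℝ^d. Then the control system with control family 𝓕 possesses the exact universal interpolation property if and only if there exists f = (f_1, …, f_d) ∈ 𝓕 such that at least one component f_j : ℝ^d → ℝ is not an affine function. -/
open MeasureTheory

/-- `φ` is the time-`t` flow map of the vector field `f` on `ℝ^d`:
for every initial point `x₀` there is a solution curve `γ` of `γ' = f ∘ γ`
on `[0, t]` with `γ 0 = x₀` and `γ t = φ x₀`. -/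
def IsFlowMap {d : ℕ} (f : (Fin d → ℝ) → (Fin d → ℝ)) (t : ℝ)
    (φ : (Fin d → ℝ) → (Fin d → ℝ)) : Prop :=
  ∀ x₀ : Fin d → ℝ, ∃ γ : ℝ → (Fin d → ℝ),
    γ 0 = x₀ ∧ γ t = φ x₀ ∧ ∀ s ∈ Set.Icc (0 : ℝ) t, HasDerivAt γ (f (γ s)) s

/-- The attainable set `𝓐_𝓕`: all finite compositions
`φ_{t_k}^{f_k} ∘ ⋯ ∘ φ_{t_1}^{f_1}` with `k ≥ 1`, `t_i ≥ 0`, `f_i ∈ 𝓕`. -/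
def Attainable {d : ℕ} (F : Set ((Fin d → ℝ) → (Fin d → ℝ))) :
    Set ((Fin d → ℝ) → (Fin d → ℝ)) :=
  { φ | ∃ (k : ℕ), 0 < k ∧ ∃ (f : Fin k → ((Fin d → ℝ) → (Fin d → ℝ)))
      (t : Fin k → ℝ) (φs : Fin k → ((Fin d → ℝ) → (Fin d → ℝ))),
      (∀ i, f i ∈ F) ∧ (∀ i, 0 ≤ t i) ∧ (∀ i, IsFlowMap (f i) (t i) (φs i)) ∧
      φ = (List.ofFn φs).foldr (· ∘ ·) id }

/-- Exact universal interpolation property: any finite family of pairwise distinct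
inputs can be steered exactly to any pairwise distinct targets by some flow map. -/
def ExactUIP {d : ℕ} (F : Set ((Fin d → ℝ) → (Fin d → ℝ))) : Prop :=
  ∀ (N : ℕ) (x y : Fin N → (Fin d → ℝ)),
    Function.Injective x → Function.Injective y →
    ∃ φ ∈ Attainable F, ∀ i, φ (x i) = y i

/-- The iterated forward differences of order `n` of `g`, with arbitrary steps, vanish. -/
def VanishingDifferences : ℕ → (ℝ → ℝ) → Prop
  | 0, g => ∀ x, g x = 0
  | n + 1, g => ∀ u, VanishingDifferences n fun x => g (x + u) - g x

lemma VanishingDifferences.succ {n : ℕ} {g : ℝ → ℝ} (h : VanishingDifferences n g) :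
    VanishingDifferences (n + 1) g := by
  induction n generalizing g with
  | zero =>
    intro u x
    have h' : ∀ x, g x = 0 := h
    simp [h']
  | succ n ih => exact fun u => ih (h u)

/-- A bounded function whose differences of some positive order vanish is constant. -/
lemma VanishingDifferences.one_of_bounded {n : ℕ} {g : ℝ → ℝ} {C : ℝ} (hC : ∀ x, |g x| ≤ C)
    (h : VanishingDifferences (n + 1) g) : VanishingDifferences 1 g := by
  induction n generalizing g C with
  | zero => exact h
  | succ n ih =>
    intro u
    have hb : ∀ x, |g (x + u) - g x| ≤ C + C := fun x =>
      (abs_sub _ _).trans (add_le_add (hC _) (hC _))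
    have hper : ∀ x, g (x + u + u) - g (x + u) - (g (x + u) - g x) = 0 := ih hb (h u) u
    intro x
    have hlin : ∀ m : ℕ, g (x + m * u + u) - g (x + m * u) = g (x + u) - g x ∧
        g (x + m * u) - g x = m * (g (x + u) - g x) := by
      intro m
      induction m with
      | zero => simp
      | succ m ihm =>
        have e : x + ((m + 1 : ℕ) : ℝ) * u = x + m * u + u := by push_cast; ring
        rw [e]
        have := hper (x + m * u)
        refine ⟨by linarith [ihm.1], ?_⟩
        push_cast
        linarith [ihm.1, ihm.2]
    change g (x + u) - g x = 0
    by_contra hne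
    obtain ⟨m, hm⟩ := exists_nat_gt ((C + C) / |g (x + u) - g x|)
    rw [div_lt_iff₀ (abs_pos.2 hne)] at hm
    have h₁ : |g (x + m * u) - g x| ≤ C + C := (abs_sub _ _).trans (add_le_add (hC _) (hC _))
    rw [(hlin m).2, abs_mul, Nat.abs_cast] at h₁
    exact absurd h₁ (not_le.2 hm)

lemma VanishingDifferences.two_of_lipschitz {n : ℕ} {g : ℝ → ℝ} {L : NNReal}
    (hL : LipschitzWith L g) (h : VanishingDifferences n g) : VanishingDifferences 2 g := by
  intro u
  refine VanishingDifferences.one_of_bounded (n := n) (C := L * |u|) (fun x => ?_) (h.succ.succ u)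
  simpa [Real.dist_eq] using hL.dist_le_mul (x + u) x

lemma vanishingDifferences_of_sum_eq_zero (s₀ : ℝ) (T : Finset ℝ) (hT : s₀ ∉ T) (H : ℝ → ℝ → ℝ)
    (hH : ∀ α b, H s₀ (α * s₀ + b) + ∑ s ∈ T, H s (α * s + b) = 0) :
    VanishingDifferences T.card (H s₀) := by
  induction T using Finset.induction_on generalizing H with
  | empty =>
    intro x
    simpa using hH 0 x
  | insert t T ht ih =>
    rw [Finset.card_insert_of_notMem ht]
    intro u
    have hne : s₀ - t ≠ 0 := sub_ne_zero.2 fun h => hT (by simp [h])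
    have key := ih (fun h => hT (Finset.mem_insert_of_mem h))
      (fun s x => H s (x + u / (s₀ - t) * (s - t)) - H s x) (by
        intro α b
        have h₁ := hH (α + u / (s₀ - t)) (b - u / (s₀ - t) * t)
        have h₂ := hH α b
        rw [Finset.sum_insert ht] at h₁ h₂
        have e : ∀ s, (α + u / (s₀ - t)) * s + (b - u / (s₀ - t) * t)
            = α * s + b + u / (s₀ - t) * (s - t) := fun s => by ring
        simp only [e, sub_self, mul_zero, add_zero] at h₁
        rw [Finset.sum_sub_distrib]
        linarith)
    simpa only [div_mul_cancel₀ u hne] using key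

lemma LinearMap.apply_eq_sum_mul_single {n : ℕ} (f : (Fin n → ℝ) →ₗ[ℝ] ℝ) (x : Fin n → ℝ) :
    f x = ∑ i, x i * f (Pi.single i 1) := by
  rw [LinearMap.pi_apply_eq_sum_univ f x]
  refine Finset.sum_congr rfl fun i _ => ?_
  rw [smul_eq_mul]
  congr 2
  ext j
  simp [Pi.single_apply, eq_comm]

/-- For a Lipschitz `h` with a nonvanishing second difference, the dilated translates of `h`
interpolate arbitrary values at distinct nodes. -/
lemma span_dilated_translates_eq_top {N : ℕ} {h : ℝ → ℝ} {L : NNReal} (hL : LipschitzWith L h)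
    (hne : ¬ VanishingDifferences 2 h) {s : Fin N → ℝ} (hs : Function.Injective s) :
    Submodule.span ℝ {c : Fin N → ℝ | ∃ α b, ∀ i, c i = h (α * s i + b)} = ⊤ := by
  by_contra htop
  obtain ⟨f, hf0, hf⟩ := Submodule.exists_le_ker_of_lt_top _ (lt_top_iff_ne_top.2 htop)
  have hsum : ∀ α b, ∑ i, h (α * s i + b) * f (Pi.single i 1) = 0 := by
    intro α b
    have := hf (Submodule.subset_span ⟨α, b, fun i => rfl⟩)
    rwa [LinearMap.mem_ker, LinearMap.apply_eq_sum_mul_single] at this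
  obtain ⟨i₀, hi₀⟩ : ∃ i, f (Pi.single i 1) ≠ 0 := by
    by_contra! hz
    exact hf0 (LinearMap.pi_ext' fun i => LinearMap.ext_ring (by simpa using hz i))
  have : Nonempty (Fin N) := ⟨i₀⟩
  have hinv : ∀ i, Function.invFun s (s i) = i := Function.leftInverse_invFun hs
  have hv := vanishingDifferences_of_sum_eq_zero (s i₀) ((Finset.univ.erase i₀).image s)
    (by simp [hs.eq_iff]) (fun r x => h x * f (Pi.single (Function.invFun s r) 1)) (by
      intro α b
      rw [Finset.sum_image hs.injOn]
      simp only [hinv]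
      rw [← hsum α b, ← Finset.add_sum_erase _ _ (Finset.mem_univ i₀)])
  simp only [hinv] at hv
  have hscale : ∀ (n : ℕ) (g : ℝ → ℝ), VanishingDifferences n (fun x => g x * f (Pi.single i₀ 1)) →
      VanishingDifferences n g := by
    intro n
    induction n with
    | zero => exact fun g hg x => (mul_eq_zero.1 (hg x)).resolve_right hi₀
    | succ n ih =>
      intro g hg u
      apply ih
      simpa only [sub_mul] using hg u
  exact hne ((hscale _ _ hv).two_of_lipschitz hL)

lemma foldr_comp_eq {α : Type*} (l : List (α → α)) (g : α → α) :
    l.foldr (· ∘ ·) g = l.foldr (· ∘ ·) id ∘ g := by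
  induction l with
  | nil => rfl
  | cons a l ih => simp [ih, Function.comp_assoc]

lemma IsFlowMap.mem_attainable {d : ℕ} {F : Set ((Fin d → ℝ) → (Fin d → ℝ))}
    {f φ : (Fin d → ℝ) → (Fin d → ℝ)} {t : ℝ} (h : IsFlowMap f t φ) (hf : f ∈ F) (ht : 0 ≤ t) :
    φ ∈ Attainable F :=
  ⟨1, one_pos, fun _ => f, fun _ => t, fun _ => φ, fun _ => hf, fun _ => ht, fun _ => h, by simp⟩

lemma Attainable.comp {d : ℕ} {F : Set ((Fin d → ℝ) → (Fin d → ℝ))}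
    {φ ψ : (Fin d → ℝ) → (Fin d → ℝ)} (hφ : φ ∈ Attainable F) (hψ : ψ ∈ Attainable F) :
    φ ∘ ψ ∈ Attainable F := by
  obtain ⟨k, hk, f, t, φs, hf, ht, hfl, rfl⟩ := hφ
  obtain ⟨l, -, g, u, ψs, hg, hu, hgl, rfl⟩ := hψ
  refine ⟨k + l, by omega, Fin.append f g, Fin.append t u, Fin.append φs ψs, ?_, ?_, ?_, ?_⟩
  · intro i
    refine Fin.addCases (fun i => ?_) (fun i => ?_) i <;> simp [hf, hg]
  · intro i
    refine Fin.addCases (fun i => ?_) (fun i => ?_) i <;> simp [ht, hu]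
  · intro i
    refine Fin.addCases (fun i => ?_) (fun i => ?_) i <;> simp [hfl, hgl]
  · rw [List.ofFn_fin_append, List.foldr_append, ← foldr_comp_eq]

/-- `φ` preserves midpoints. -/
def PreservesMidpoints {E : Type*} [AddCommGroup E] [Module ℝ E] (φ : E → E) : Prop :=
  ∀ x y z : E, x + z = (2 : ℝ) • y → φ x + φ z = (2 : ℝ) • φ y

lemma IsFlowMap.preservesMidpoints {d : ℕ} {f φ : (Fin d → ℝ) → (Fin d → ℝ)} {t : ℝ}
    {L : NNReal} (hL : LipschitzWith L f) (hf : PreservesMidpoints f) (ht : 0 ≤ t)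
    (h : IsFlowMap f t φ) : PreservesMidpoints φ := by
  intro x y z hxyz
  obtain ⟨α, hα0, hαt, hα⟩ := h x
  obtain ⟨β, hβ0, hβt, hβ⟩ := h y
  obtain ⟨γ, hγ0, hγt, hγ⟩ := h z
  have hm : ∀ s ∈ Set.Icc (0 : ℝ) t, HasDerivAt (fun s => (2⁻¹ : ℝ) • (α s + γ s))
      (f ((2⁻¹ : ℝ) • (α s + γ s))) s := by
    intro s hs
    have e : (2⁻¹ : ℝ) • (f (α s) + f (γ s)) = f ((2⁻¹ : ℝ) • (α s + γ s)) := by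
      rw [hf (α s) ((2⁻¹ : ℝ) • (α s + γ s)) (γ s) (by simp), inv_smul_smul₀ two_ne_zero]
    rw [← e]
    exact ((hα s hs).add (hγ s hs)).const_smul (2⁻¹ : ℝ)
  have hu := ODE_solution_unique (v := fun _ => f) (fun _ => hL)
    (fun s hs => (hm s hs).continuousAt.continuousWithinAt)
    (fun s hs => (hm s (Set.Ico_subset_Icc_self hs)).hasDerivWithinAt)
    (fun s hs => (hβ s hs).continuousAt.continuousWithinAt)
    (fun s hs => (hβ s (Set.Ico_subset_Icc_self hs)).hasDerivWithinAt)
    (by simp [hα0, hβ0, hγ0, hxyz])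
  have := hu (Set.right_mem_Icc.2 ht)
  simp only [hαt, hβt, hγt] at this
  rw [← this, smul_inv_smul₀ two_ne_zero]

lemma Attainable.preservesMidpoints {d : ℕ} {F : Set ((Fin d → ℝ) → (Fin d → ℝ))}
    (hLip : ∀ f ∈ F, ∃ L : NNReal, LipschitzWith L f) (hF : ∀ f ∈ F, PreservesMidpoints f)
    {φ : (Fin d → ℝ) → (Fin d → ℝ)} (hφ : φ ∈ Attainable F) : PreservesMidpoints φ := by
  obtain ⟨k, -, f, t, φs, hf, ht, hfl, rfl⟩ := hφ
  have hl : ∀ g ∈ List.ofFn φs, PreservesMidpoints g := by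
    intro g hg
    obtain ⟨i, rfl⟩ := (List.mem_ofFn' _ _).1 hg
    obtain ⟨L, hL⟩ := hLip _ (hf i)
    exact (hfl i).preservesMidpoints hL (hF _ (hf i)) (ht i)
  generalize List.ofFn φs = l at hl
  induction l with
  | nil => exact fun x y z h => h
  | cons g l ih =>
    intro x y z h
    exact hl g (by simp) _ _ _ (ih (fun g hg => hl g (by simp [hg])) x y z h)

lemma not_exactUIP_of_preservesMidpoints {d : ℕ} (hd : 0 < d)
    {F : Set ((Fin d → ℝ) → (Fin d → ℝ))} (hF : ∀ φ ∈ Attainable F, PreservesMidpoints φ) :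
    ¬ ExactUIP F := by
  intro h
  have hinj : ∀ r : Fin 3 → ℝ, Function.Injective r →
      Function.Injective fun i => (fun _ => r i : Fin d → ℝ) :=
    fun r hr i j hij => hr (congrFun hij ⟨0, hd⟩)
  obtain ⟨φ, hφ, hφi⟩ := h 3 (fun i _ => ![0, 1, 2] i) (fun i _ => ![0, 1, 3] i)
    (hinj _ fun i j => by fin_cases i <;> fin_cases j <;> simp)
    (hinj _ fun i j => by fin_cases i <;> fin_cases j <;> simp)
  have h0 := hφi 0
  have h1 := hφi 1
  have h2 := hφi 2
  have hm := hF φ hφ _ _ _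
    (show (fun _ => ![0, 1, 2] (0 : Fin 3) : Fin d → ℝ) + (fun _ => ![0, 1, 2] (2 : Fin 3))
      = (2 : ℝ) • (fun _ => ![0, 1, 2] (1 : Fin 3)) by ext; simp)
  rw [h0, h1, h2] at hm
  have : (0 : ℝ) + 3 = 2 * 1 := congrFun hm ⟨0, hd⟩
  norm_num at this

lemma exists_affine_of_midpoint {d : ℕ} {g : (Fin d → ℝ) → ℝ} (hg : Continuous g)
    (hm : ∀ x z, g x + g z = 2 * g ((2⁻¹ : ℝ) • (x + z))) :
    ∃ (a : Fin d → ℝ) (c : ℝ), ∀ x, g x = (∑ i, a i * x i) + c := by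
  let G : (Fin d → ℝ) →+ ℝ := AddMonoidHom.mk' (fun x => g x - g 0) (by
    intro x z
    have h₁ := hm x z
    have h₂ := hm (x + z) 0
    rw [add_zero] at h₂
    linarith)
  let M : (Fin d → ℝ) →L[ℝ] ℝ := G.toRealLinearMap (hg.sub continuous_const)
  refine ⟨fun i => M (Pi.single i 1), g 0, fun x => ?_⟩
  have h₁ : M x = g x - g 0 := rfl
  have h₂ := LinearMap.apply_eq_sum_mul_single M.toLinearMap x
  simp only [ContinuousLinearMap.coe_coe] at h₂
  rw [h₁] at h₂
  simp only [mul_comm (M _)]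
  linarith

/-- A nonaffine member of an affine invariant family yields all ridge fields with a common
nonaffine Lipschitz profile. -/
lemma exists_ridge_fields {d : ℕ} {F : Set ((Fin d → ℝ) → (Fin d → ℝ))}
    (hAff : ∀ f ∈ F, ∀ (W A : Matrix (Fin d) (Fin d) ℝ) (b : Fin d → ℝ),
      (fun x => W.mulVec (f (A.mulVec x - b))) ∈ F)
    {f : (Fin d → ℝ) → (Fin d → ℝ)} (hf : f ∈ F) {L : NNReal} (hL : LipschitzWith L f) {j : Fin d}
    (hj : ¬ ∃ (a : Fin d → ℝ) (c : ℝ), ∀ x : Fin d → ℝ, f x j = (∑ i, a i * x i) + c) :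
    ∃ (h : ℝ → ℝ) (K : NNReal), LipschitzWith K h ∧ ¬ VanishingDifferences 2 h ∧
      ∀ (w a : Fin d → ℝ) (b : ℝ), (fun x => h (a ⬝ᵥ x + b) • w) ∈ F := by
  have hcont : Continuous fun x => f x j := (continuous_apply j).comp hL.continuous
  have hex : ∃ x z, f x j + f z j ≠ 2 * f ((2⁻¹ : ℝ) • (x + z)) j := by
    by_contra! hall
    exact hj (exists_affine_of_midpoint hcont hall)
  obtain ⟨x, z, hxz⟩ := hex
  have hline : LipschitzWith ‖z - x‖₊ fun s : ℝ => x + s • (z - x) := by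
    refine LipschitzWith.of_dist_le_mul fun s t => ?_
    rw [dist_add_left, dist_eq_norm, ← sub_smul, norm_smul, mul_comm, coe_nnnorm, dist_eq_norm]
  refine ⟨fun s => f (x + s • (z - x)) j, _,
    (LipschitzWith.eval j).comp (hL.comp hline), fun hv => hxz ?_, fun w a b => ?_⟩
  · have h₀ := hv 2⁻¹ 2⁻¹ 0
    have e₁ : x + (2⁻¹ : ℝ) • (z - x) = (2⁻¹ : ℝ) • (x + z) := by module
    have e₂ : x + (2⁻¹ + 2⁻¹ : ℝ) • (z - x) = z := by module
    simp only [zero_add, e₁, e₂, zero_smul, add_zero] at h₀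
    linarith
  · convert hAff f hf (Matrix.vecMulVec w (Pi.single j 1)) (Matrix.vecMulVec (z - x) a)
      (-(x + b • (z - x))) using 2 with y
    rw [Matrix.vecMulVec_mulVec, Matrix.vecMulVec_mulVec]
    have e : x + (a ⬝ᵥ y + b) • (z - x)
        = MulOpposite.op (a ⬝ᵥ y) • (z - x) - -(x + b • (z - x)) := by
      rw [op_smul_eq_smul]; module
    beta_reduce
    rw [e]
    simp

lemma isFlowMap_shear {d : ℕ} (h : ℝ → ℝ) {w a : Fin d → ℝ} (haw : a ⬝ᵥ w = 0) (b : ℝ) :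
    IsFlowMap (fun x => h (a ⬝ᵥ x + b) • w) 1 (fun x => x + h (a ⬝ᵥ x + b) • w) := by
  intro x
  refine ⟨fun s => x + s • h (a ⬝ᵥ x + b) • w, by simp, by simp, fun s _ => ?_⟩
  have e : a ⬝ᵥ (x + s • h (a ⬝ᵥ x + b) • w) = a ⬝ᵥ x := by simp [dotProduct_add, haw]
  simp only [e]
  simpa using ((hasDerivAt_id s).smul_const (h (a ⬝ᵥ x + b) • w)).const_add x

/-- Compositions of ridge shears interpolate arbitrary shear amplitudes. -/
lemma exists_attainable_shear {d N : ℕ} {F : Set ((Fin d → ℝ) → (Fin d → ℝ))} {h : ℝ → ℝ}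
    {K : NNReal} (hK : LipschitzWith K h) (hne : ¬ VanishingDifferences 2 h)
    (hF : ∀ (w a : Fin d → ℝ) (b : ℝ), (fun x => h (a ⬝ᵥ x + b) • w) ∈ F)
    {s : Fin N → ℝ} (hs : Function.Injective s) (c : Fin N → ℝ) {w a : Fin d → ℝ}
    (haw : a ⬝ᵥ w = 0) :
    ∃ φ ∈ Attainable F, ∀ x i, a ⬝ᵥ x = s i → φ x = x + c i • w := by
  have hc : c ∈ Submodule.span ℝ {c : Fin N → ℝ | ∃ α b, ∀ i, c i = h (α * s i + b)} := by
    rw [span_dilated_translates_eq_top hK hne hs]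
    trivial
  induction hc using Submodule.span_induction generalizing w with
  | mem c hc =>
    obtain ⟨α, b, hc⟩ := hc
    refine ⟨_, (isFlowMap_shear h (w := w) (a := α • a) (by simp [haw]) b).mem_attainable
      (hF _ _ _) zero_le_one, fun x i hx => ?_⟩
    simp [hc, hx]
  | zero =>
    exact ⟨_, (isFlowMap_shear h (w := 0) (a := a) (by simp) 0).mem_attainable (hF _ _ _)
      zero_le_one, by simp⟩
  | add c₁ c₂ _ _ ih₁ ih₂ =>
    obtain ⟨φ, hφ, hφx⟩ := ih₁ haw
    obtain ⟨ψ, hψ, hψx⟩ := ih₂ haw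
    refine ⟨φ ∘ ψ, Attainable.comp hφ hψ, fun x i hx => ?_⟩
    rw [Function.comp_apply, hψx x i hx, hφx _ i (by simp [dotProduct_add, haw, hx]),
      Pi.add_apply]
    module
  | smul r c _ ih =>
    obtain ⟨φ, hφ, hφx⟩ := ih (w := r • w) (by simp [haw])
    refine ⟨φ, hφ, fun x i hx => ?_⟩
    rw [hφx x i hx, Pi.smul_apply, smul_eq_mul]
    module

/-- Points separated by `a ⬝ᵥ ·` can be moved independently inside the level sets of `a ⬝ᵥ ·`. -/
lemma exists_attainable_of_dotProduct_eq {d N : ℕ} {F : Set ((Fin d → ℝ) → (Fin d → ℝ))}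
    {h : ℝ → ℝ} {K : NNReal} (hK : LipschitzWith K h) (hne : ¬ VanishingDifferences 2 h)
    (hF : ∀ (w a : Fin d → ℝ) (b : ℝ), (fun x => h (a ⬝ᵥ x + b) • w) ∈ F)
    {a : Fin d → ℝ} {x y : Fin N → (Fin d → ℝ)} (hx : Function.Injective fun i => a ⬝ᵥ x i)
    (hxy : ∀ i, a ⬝ᵥ x i = a ⬝ᵥ y i) : ∃ φ ∈ Attainable F, ∀ i, φ (x i) = y i := by
  have key : ∀ S : Finset (Fin N), ∃ φ ∈ Attainable F,
      ∀ i, φ (x i) = if i ∈ S then y i else x i := by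
    intro S
    induction S using Finset.induction_on with
    | empty =>
      exact ⟨_, (isFlowMap_shear h (w := 0) (a := a) (by simp) 0).mem_attainable (hF _ _ _)
        zero_le_one, by simp⟩
    | insert k S hk ih =>
      obtain ⟨φ, hφ, hφx⟩ := ih
      obtain ⟨ψ, hψ, hψx⟩ := exists_attainable_shear hK hne hF hx (Pi.single k 1)
        (w := y k - x k) (a := a) (by rw [dotProduct_sub, hxy, sub_self])
      refine ⟨ψ ∘ φ, Attainable.comp hψ hφ, fun i => ?_⟩
      rw [Function.comp_apply, hψx (φ (x i)) i (by rw [hφx]; split_ifs <;> simp [hxy]), hφx]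
      by_cases hik : i = k
      · subst hik
        simp [hk]
      · simp [hik]
  simpa using key Finset.univ

/-- Some point of the moment curve separates two given finite families of vectors. -/
lemma exists_moment_separating {d N : ℕ} {x y : Fin N → (Fin d → ℝ)} (hx : Function.Injective x)
    (hy : Function.Injective y) :
    ∃ t : ℝ, Function.Injective (fun i => (fun k : Fin d => t ^ (k : ℕ)) ⬝ᵥ x i) ∧
      Function.Injective (fun i => (fun k : Fin d => t ^ (k : ℕ)) ⬝ᵥ y i) := by
  have hfin : ∀ v : Fin d → ℝ, v ≠ 0 →
      {t : ℝ | (fun k : Fin d => t ^ (k : ℕ)) ⬝ᵥ v = 0}.Finite := by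
    intro v hv
    obtain ⟨k, hk⟩ := Function.ne_iff.1 hv
    let p : Polynomial ℝ := ∑ i : Fin d, Polynomial.monomial (i : ℕ) (v i)
    have hp : p ≠ 0 := by
      intro h0
      apply hk
      have := congrArg (fun q => Polynomial.coeff q k) h0
      simpa [p, Polynomial.finsetSum_coeff, Polynomial.coeff_monomial, Fin.val_inj] using this
    refine p.rootSet_finite ℝ |>.subset fun t ht => ?_
    rw [Polynomial.mem_rootSet]
    refine ⟨hp, ?_⟩
    rw [Set.mem_ofPred_eq, dotProduct] at ht
    simpa [p, mul_comm] using ht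
  have hbad : ∀ {z : Fin N → (Fin d → ℝ)}, Function.Injective z →
      (⋃ i, ⋃ j, ⋃ (_ : i ≠ j),
        {t : ℝ | (fun k : Fin d => t ^ (k : ℕ)) ⬝ᵥ (z i - z j) = 0}).Finite := fun hz =>
    Set.finite_iUnion fun i => Set.finite_iUnion fun j => Set.finite_iUnion fun hij =>
      hfin _ (sub_ne_zero.2 (hz.ne hij))
  obtain ⟨t, ht⟩ := ((hbad hx).union (hbad hy)).exists_notMem
  simp only [Set.mem_union, Set.mem_iUnion, Set.mem_ofPred_eq, not_or, not_exists,
    dotProduct_sub, sub_eq_zero] at ht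
  exact ⟨t, fun i j h => by_contra fun hij => ht.1 i j hij h,
    fun i j h => by_contra fun hij => ht.2 i j hij h⟩

lemma exactUIP_of_ridge_fields {d : ℕ} (hd : 2 ≤ d) {F : Set ((Fin d → ℝ) → (Fin d → ℝ))}
    {h : ℝ → ℝ} {K : NNReal} (hK : LipschitzWith K h) (hne : ¬ VanishingDifferences 2 h)
    (hF : ∀ (w a : Fin d → ℝ) (b : ℝ), (fun x => h (a ⬝ᵥ x + b) • w) ∈ F) : ExactUIP F := by
  intro N x y hx hy
  obtain ⟨t, htx, hty⟩ := exists_moment_separating hx hy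
  let a : Fin d → ℝ := fun k => t ^ (k : ℕ)
  let k₀ : Fin d := ⟨0, by omega⟩
  let k₁ : Fin d := ⟨1, by omega⟩
  let b : Fin d → ℝ := Pi.single k₁ 1
  let z : (Fin N → (Fin d → ℝ)) → Fin N → (Fin d → ℝ) := fun x i =>
    Pi.single k₁ (i : ℝ) + Pi.single k₀ (a ⬝ᵥ x i - i * t)
  have haz : ∀ x i, a ⬝ᵥ z x i = a ⬝ᵥ x i := by
    intro x i
    simp only [z, dotProduct_add, dotProduct_single]
    simp only [a, k₀, k₁, pow_zero, pow_one]
    ring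
  have hbz : ∀ x i, b ⬝ᵥ z x i = (i : ℝ) := by
    intro x i
    simp [z, b, k₀, k₁]
  obtain ⟨φ₁, hφ₁, h₁⟩ := exists_attainable_of_dotProduct_eq hK hne hF (a := a) (x := x) (y := z x)
    htx fun i => (haz x i).symm
  obtain ⟨φ₂, hφ₂, h₂⟩ := exists_attainable_of_dotProduct_eq hK hne hF (a := b) (x := z x)
    (y := z y) (fun i j hij => by simpa [hbz, Fin.val_inj] using hij) fun i => by rw [hbz, hbz]
  obtain ⟨φ₃, hφ₃, h₃⟩ := exists_attainable_of_dotProduct_eq hK hne hF (a := a) (x := z y) (y := y)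
    (by simpa only [haz] using hty) (haz y)
  exact ⟨φ₃ ∘ φ₂ ∘ φ₁, Attainable.comp hφ₃ (Attainable.comp hφ₂ hφ₁), fun i => by simp [h₁, h₂, h₃]⟩

/-- Theorem 2.5 (characterisation of UIP under affine invariance). -/
theorem uip_iff_nonlinear_of_affine_invariant {d : ℕ} (hd : 2 ≤ d)
    (F : Set ((Fin d → ℝ) → (Fin d → ℝ)))
    (hLip : ∀ f ∈ F, ∃ L : NNReal, LipschitzWith L f)
    (hAff : ∀ f ∈ F, ∀ (W A : Matrix (Fin d) (Fin d) ℝ) (b : Fin d → ℝ),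
      (fun x => W.mulVec (f (A.mulVec x - b))) ∈ F) :
    ExactUIP F ↔
      ∃ f ∈ F, ∃ j : Fin d,
        ¬ ∃ (a : Fin d → ℝ) (c : ℝ), ∀ x : Fin d → ℝ, f x j = (∑ i, a i * x i) + c := by
  constructor
  · intro hU
    by_contra! hall
    refine not_exactUIP_of_preservesMidpoints (by omega)
      (fun φ hφ => Attainable.preservesMidpoints hLip (fun f hf x y z hxyz => ?_) hφ) hU
    ext j
    obtain ⟨a, c, hac⟩ := hall f hf j
    have hsum : ∑ i, a i * x i + ∑ i, a i * z i = 2 * ∑ i, a i * y i := by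
      rw [← Finset.sum_add_distrib, Finset.mul_sum]
      refine Finset.sum_congr rfl fun i _ => ?_
      have := congrFun hxyz i
      simp only [Pi.add_apply, Pi.smul_apply, smul_eq_mul] at this
      linear_combination a i * this
    simp only [Pi.add_apply, Pi.smul_apply, smul_eq_mul, hac]
    linarith
  · rintro ⟨f, hf, j, hj⟩
    obtain ⟨L, hL⟩ := hLip f hf
    obtain ⟨h, K, hK, hne, hF⟩ := exists_ridge_fields hAff hf hL hj
    exact exactUIP_of_ridge_fields hd hK hne hF
end

section
/- Let d ≥ 2 and let σ : ℝ → ℝ be a Lipschitz function that is not affine, applied componentwise to vectors in ℝ^d. Then the continuous-time ResNet control family 𝓕 = { x ↦ W σ(Ax + b) : W, A ∈ ℝ^{d×d}, b ∈ ℝ^d } possesses the exact universal interpolation property. -/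
open MeasureTheory

/-- The continuous-time ResNet control family
`𝓕 = { x ↦ W σ(Ax + b) : W, A ∈ ℝ^{d×d}, b ∈ ℝ^d }`, where `σ` acts componentwise. -/
def ResNetFamily (d : ℕ) (σ : ℝ → ℝ) : Set ((Fin d → ℝ) → (Fin d → ℝ)) :=
  { f | ∃ (W A : Matrix (Fin d) (Fin d) ℝ) (b : Fin d → ℝ),
      f = fun x => W.mulVec (fun i => σ (A.mulVec x i + b i)) }

/-- `φ` is the time-`t` flow map of some field in `F`, for some `t ≥ 0`. -/
def IsElementaryFlow {d : ℕ} (F : Set ((Fin d → ℝ) → (Fin d → ℝ)))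
    (φ : (Fin d → ℝ) → (Fin d → ℝ)) : Prop :=
  ∃ f ∈ F, ∃ t : ℝ, 0 ≤ t ∧ IsFlowMap f t φ

/-- Some attainable map sends each `x i` to `y i`. -/
def Reach {d N : ℕ} (F : Set ((Fin d → ℝ) → (Fin d → ℝ))) (x y : Fin N → (Fin d → ℝ)) : Prop :=
  ∃ φ ∈ Attainable F, ∀ i, φ (x i) = y i

theorem mem_attainable_iff {d : ℕ} {F : Set ((Fin d → ℝ) → (Fin d → ℝ))}
    {φ : (Fin d → ℝ) → (Fin d → ℝ)} :
    φ ∈ Attainable F ↔ ∃ l : List ((Fin d → ℝ) → (Fin d → ℝ)), l ≠ [] ∧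
      (∀ ψ ∈ l, IsElementaryFlow F ψ) ∧ φ = l.foldr (· ∘ ·) id := by
  constructor
  · rintro ⟨k, hk, f, t, φs, hf, ht, hφs, rfl⟩
    refine ⟨List.ofFn φs, ?_, ?_, rfl⟩
    · simpa [List.ofFn_eq_nil_iff] using hk.ne'
    · intro ψ hψ
      obtain ⟨i, rfl⟩ := List.mem_ofFn.1 hψ
      exact ⟨f i, hf i, t i, ht i, hφs i⟩
  · rintro ⟨l, hl, h, rfl⟩
    choose f hf t ht hφ using fun i : Fin l.length => h (l.get i) (List.get_mem l i)
    exact ⟨l.length, List.length_pos_of_ne_nil hl, f, t, l.get, hf, ht, hφ, by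
      rw [List.ofFn_get]⟩

theorem foldr_comp_append {α : Type*} (l₁ l₂ : List (α → α)) :
    (l₁ ++ l₂).foldr (· ∘ ·) id = l₁.foldr (· ∘ ·) id ∘ l₂.foldr (· ∘ ·) id := by
  induction l₁ with
  | nil => rfl
  | cons a l ih => simp only [List.cons_append, List.foldr_cons, ih, Function.comp_assoc]

theorem Reach.trans {d N : ℕ} {F : Set ((Fin d → ℝ) → (Fin d → ℝ))}
    {x y z : Fin N → (Fin d → ℝ)} (hxy : Reach F x y) (hyz : Reach F y z) : Reach F x z := by
  obtain ⟨φ, hφ, hx⟩ := hxy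
  obtain ⟨ψ, hψ, hy⟩ := hyz
  rw [mem_attainable_iff] at hφ hψ
  obtain ⟨l₁, h₁, e₁, rfl⟩ := hφ
  obtain ⟨l₂, h₂, e₂, rfl⟩ := hψ
  refine ⟨_, mem_attainable_iff.2 ⟨l₂ ++ l₁, by simp [h₁], ?_, rfl⟩, fun i => ?_⟩
  · intro χ hχ
    rcases List.mem_append.1 hχ with h | h
    exacts [e₂ χ h, e₁ χ h]
  · rw [foldr_comp_append, Function.comp_apply, hx, hy]

theorem IsElementaryFlow.reach {d N : ℕ} {F : Set ((Fin d → ℝ) → (Fin d → ℝ))}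
    {φ : (Fin d → ℝ) → (Fin d → ℝ)} (hφ : IsElementaryFlow F φ) (x : Fin N → (Fin d → ℝ)) :
    Reach F x (fun i => φ (x i)) :=
  ⟨φ, mem_attainable_iff.2 ⟨[φ], by simp, by simpa using hφ, rfl⟩, fun _ => rfl⟩

/-- A ridge field `x ↦ σ (s a·x + b) w` with `a·w = 0` has a shear as its time-one flow map. -/
theorem isElementaryFlow_shear {d : ℕ} (hd : 2 ≤ d) (σ : ℝ → ℝ) (a w : Fin d → ℝ)
    (haw : a ⬝ᵥ w = 0) (s b : ℝ) :
    IsElementaryFlow (ResNetFamily d σ) (fun x => x + σ (s * (a ⬝ᵥ x) + b) • w) := by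
  refine ⟨fun x => σ (s * (a ⬝ᵥ x) + b) • w, ?_, 1, zero_le_one, ?_⟩
  · refine ⟨Matrix.of fun j k => if k = ⟨0, by omega⟩ then w j else 0,
      Matrix.of fun _ k => s * a k, fun _ => b, ?_⟩
    funext x j
    simp [Matrix.mulVec, dotProduct, Finset.mul_sum, mul_assoc, mul_comm (w j)]
  · intro x
    refine ⟨fun τ => x + τ • (σ (s * (a ⬝ᵥ x) + b) • w), by simp, by simp, fun τ _ => ?_⟩
    have h : a ⬝ᵥ (x + τ • (σ (s * (a ⬝ᵥ x) + b) • w)) = a ⬝ᵥ x := by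
      simp [dotProduct_add, dotProduct_smul, haw]
    simp only [h]
    simpa using ((hasDerivAt_id τ).smul_const (σ (s * (a ⬝ᵥ x) + b) • w)).const_add x

/-- All forward differences of order `n` of `g` vanish. -/
def DiffVanish : ℕ → (ℝ → ℝ) → Prop
  | 0, g => ∀ x, g x = 0
  | n + 1, g => ∀ h, DiffVanish n (fun x => g (x + h) - g x)

theorem diffVanish_of_sum_eq_zero {ι : Type*} [DecidableEq ι] {u : ι → ℝ}
    (hu : Function.Injective u) (i₀ : ι) (T : Finset ι) (hT : i₀ ∉ T) (g : ι → ℝ → ℝ)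
    (h : ∀ s b, g i₀ (s * u i₀ + b) + ∑ i ∈ T, g i (s * u i + b) = 0) :
    DiffVanish T.card (g i₀) := by
  induction T using Finset.induction_on generalizing g with
  | empty => exact fun x => by simpa using h 0 x
  | insert v T hv ih =>
    rw [Finset.card_insert_of_notMem hv]
    intro k
    have hne : u i₀ - u v ≠ 0 := sub_ne_zero.2 (hu.ne (by grind))
    set δ := k / (u i₀ - u v) with hδ
    have hk : δ * (u i₀ - u v) = k := div_mul_cancel₀ _ hne
    have := ih (by grind) (fun i x => g i (x + δ * (u i - u v)) - g i x) (fun s b => by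
      have h₁ := h s b
      have h₂ := h (s + δ) (b - δ * u v)
      have e : ∀ i, (s + δ) * u i + (b - δ * u v) = s * u i + b + δ * (u i - u v) :=
        fun i => by ring
      simp only [e, Finset.sum_insert hv, sub_self, mul_zero, add_zero] at h₁ h₂
      simp only [Finset.sum_sub_distrib]
      linarith)
    simpa only [hk] using this

theorem eq_zero_of_abs_nat_mul_le {c C : ℝ} (h : ∀ n : ℕ, |n * c| ≤ C) : c = 0 := by
  by_contra hc
  obtain ⟨n, hn⟩ := exists_nat_gt (C / |c|)
  have := h n
  rw [abs_mul, Nat.abs_cast] at this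
  rw [div_lt_iff₀ (abs_pos.2 hc)] at hn
  linarith

theorem DiffVanish.eq_of_bounded {n : ℕ} {g : ℝ → ℝ} (hg : DiffVanish n g)
    {C : ℝ} (hC : ∀ x, |g x| ≤ C) (x h : ℝ) : g (x + h) = g x := by
  induction n generalizing g C x h with
  | zero => rw [hg, hg]
  | succ n ih =>
    have hstep : ∀ y, g (y + h + h) - g (y + h) = g (y + h) - g y := fun y =>
      ih (hg h) (C := C + C) (fun z => (abs_sub _ _).trans (add_le_add (hC _) (hC _))) y h
    have hlin : ∀ m : ℕ, g (x + m * h + h) - g (x + m * h) = g (x + h) - g x := by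
      intro m
      induction m with
      | zero => simp
      | succ m ihm =>
        rw [show x + ((m + 1 : ℕ) : ℝ) * h = x + m * h + h by push_cast; ring]
        exact (hstep _).trans ihm
    have hsum : ∀ m : ℕ, g (x + m * h) - g x = m * (g (x + h) - g x) := by
      intro m
      induction m with
      | zero => simp
      | succ m ihm =>
        have := hlin m
        push_cast
        rw [show x + (m + 1) * h = x + m * h + h by ring]
        linarith
    refine sub_eq_zero.1 (eq_zero_of_abs_nat_mul_le (C := C + C) fun m => ?_)
    rw [← hsum]
    exact (abs_sub _ _).trans (add_le_add (hC _) (hC _))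

/-- A Lipschitz function with vanishing differences of some order is affine. -/
theorem DiffVanish.affine_of_lipschitz {n : ℕ} {g : ℝ → ℝ} (hg : DiffVanish n g)
    {L : NNReal} (hL : LipschitzWith L g) : ∃ a c : ℝ, ∀ x, g x = a * x + c := by
  cases n with
  | zero => exact ⟨0, 0, fun x => by simpa using hg x⟩
  | succ n =>
    have key : ∀ h x, g (x + h) - g x = g h - g 0 := fun h x => by
      have := (hg h).eq_of_bounded (C := L * |h|) (fun z => by
        simpa [Real.dist_eq] using hL.dist_le_mul (z + h) z) 0 x
      simpa using this
    let f : ℝ →+ ℝ :=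
      { toFun := fun x => g x - g 0
        map_zero' := sub_self _
        map_add' := fun x y => by have := key y x; linarith }
    have hf : Continuous f := hL.continuous.sub continuous_const
    refine ⟨f 1, g 0, fun x => ?_⟩
    have h₁ := map_real_smul f hf x 1
    simp only [smul_eq_mul, mul_one] at h₁
    have h₂ : f x = g x - g 0 := rfl
    linarith

/-- Dilations and translations of a non-affine Lipschitz function interpolate arbitrary data on
finitely many distinct points. -/
theorem span_ridge_eq_top {ι : Type*} [Fintype ι] {u : ι → ℝ} (hu : Function.Injective u)
    {σ : ℝ → ℝ} (hLip : ∃ L : NNReal, LipschitzWith L σ)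
    (hNonAffine : ¬ ∃ (a c : ℝ), ∀ x : ℝ, σ x = a * x + c) :
    Submodule.span ℝ (Set.range fun p : ℝ × ℝ => fun i : ι => σ (p.1 * u i + p.2)) = ⊤ := by
  classical
  by_contra hne
  obtain ⟨f, hf, hle⟩ := Submodule.exists_le_ker_of_lt_top _ (lt_top_iff_ne_top.2 hne)
  have hex : ∃ i, f (Pi.single i 1) ≠ 0 := by
    by_contra! hall
    exact hf (LinearMap.pi_ext' fun i => LinearMap.ext_ring (by simpa using hall i))
  obtain ⟨i₀, hi₀⟩ := hex
  have hsum : ∀ s b, ∑ i, f (Pi.single i 1) * σ (s * u i + b) = 0 := fun s b => by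
    have h : f (fun i => σ (s * u i + b)) = 0 :=
      hle (Submodule.subset_span ⟨(s, b), rfl⟩)
    rw [LinearMap.pi_apply_eq_sum_univ] at h
    rw [← h]
    refine Finset.sum_congr rfl fun i _ => ?_
    rw [smul_eq_mul, mul_comm]
    congr 2
    funext j
    simp [Pi.single_apply, eq_comm]
  have hv := diffVanish_of_sum_eq_zero hu i₀ (Finset.univ.erase i₀) (by simp)
    (fun i x => f (Pi.single i 1) * σ x) (fun s b => by
      rw [← hsum s b]
      exact Finset.add_sum_erase Finset.univ (fun i => f (Pi.single i 1) * σ (s * u i + b))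
        (Finset.mem_univ i₀))
  obtain ⟨L, hL⟩ := hLip
  have hL' : LipschitzWith (‖f (Pi.single i₀ 1)‖₊ * L) (fun x => f (Pi.single i₀ 1) * σ x) :=
    (lipschitzWith_smul (f (Pi.single i₀ 1))).comp hL
  obtain ⟨a, c, hac⟩ := hv.affine_of_lipschitz hL'
  refine hNonAffine ⟨a / f (Pi.single i₀ 1), c / f (Pi.single i₀ 1), fun x => ?_⟩
  have := hac x
  field_simp
  linarith

/-- Every shear `x ↦ x + G (a·x) w` with `a·w = 0` can be realized on finitely many points. -/
theorem reach_shear {d N : ℕ} (hd : 2 ≤ d) {σ : ℝ → ℝ}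
    (hLip : ∃ L : NNReal, LipschitzWith L σ)
    (hNonAffine : ¬ ∃ (a c : ℝ), ∀ x : ℝ, σ x = a * x + c)
    (a w : Fin d → ℝ) (haw : a ⬝ᵥ w = 0) (G : ℝ → ℝ) (x : Fin N → (Fin d → ℝ)) :
    Reach (ResNetFamily d σ) x (fun i => x i + G (a ⬝ᵥ x i) • w) := by
  set S : Set ℝ := Set.range fun i => a ⬝ᵥ x i with hS
  have : Fintype S := Fintype.ofFinite S
  have hz : ∀ z ∈ Submodule.span ℝ
      (Set.range fun p : ℝ × ℝ => fun v : S => σ (p.1 * (v : ℝ) + p.2)),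
      ∀ (t : ℝ) (x' : Fin N → (Fin d → ℝ)), (∀ i, a ⬝ᵥ x' i = a ⬝ᵥ x i) →
      Reach (ResNetFamily d σ) x' (fun i => x' i + (t * z ⟨a ⬝ᵥ x i, i, rfl⟩) • w) := by
    intro z hz
    induction hz using Submodule.span_induction with
    | mem z hz =>
      obtain ⟨⟨s, b⟩, rfl⟩ := hz
      intro t x' hx'
      have h := (isElementaryFlow_shear hd σ a (t • w)
        (by rw [dotProduct_smul, haw, smul_zero]) s b).reach x'
      simpa only [hx', smul_smul, mul_comm t] using h
    | zero =>
      intro t x' hx'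
      have h := (isElementaryFlow_shear hd σ a 0 (dotProduct_zero a) 0 0).reach x'
      simpa using h
    | add z₁ z₂ _ _ h₁ h₂ =>
      intro t x' hx'
      refine (h₁ t x' hx').trans ?_
      convert h₂ t _ (fun i => ?_) using 2
      · rw [Pi.add_apply, mul_add, add_smul, add_assoc]
      · rw [dotProduct_add, dotProduct_smul, haw, smul_zero, add_zero, hx']
    | smul c z _ h =>
      intro t x' hx'
      simpa [mul_assoc] using h (t * c) x' hx'
  have htop := span_ridge_eq_top (u := fun v : S => (v : ℝ)) Subtype.val_injective hLip hNonAffine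
  simpa using hz (fun v => G v) (htop ▸ Submodule.mem_top) 1 x (fun _ => rfl)

/-- If the `p`-th coordinates are distinct, the other coordinates can be changed arbitrarily. -/
theorem reach_of_coord_injective {d N : ℕ} (hd : 2 ≤ d) {σ : ℝ → ℝ}
    (hLip : ∃ L : NNReal, LipschitzWith L σ)
    (hNonAffine : ¬ ∃ (a c : ℝ), ∀ x : ℝ, σ x = a * x + c)
    (p : Fin d) (x z : Fin N → (Fin d → ℝ)) (hx : Function.Injective fun i => x i p)
    (hxz : ∀ i, z i p = x i p) : Reach (ResNetFamily d σ) x z := by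
  have key : ∀ J : Finset (Fin d), p ∉ J →
      Reach (ResNetFamily d σ) x (fun i j => if j ∈ J then z i j else x i j) := by
    intro J
    induction J using Finset.induction_on with
    | empty =>
      intro _
      simpa using reach_shear hd hLip hNonAffine 0 0 (dotProduct_zero _) 0 x
    | insert q J hq ih =>
      intro hp
      simp only [Finset.mem_insert, not_or] at hp
      refine (ih hp.2).trans ?_
      convert reach_shear hd hLip hNonAffine (Pi.single p 1) (Pi.single q 1)
        (by simp [hp.1]) (Function.extend (fun i => x i p) (fun i => z i q - x i q) 0) _ using 2
        with i
      funext j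
      have hG : Function.extend (fun i => x i p) (fun i => z i q - x i q) 0 (x i p)
        = z i q - x i q := hx.extend_apply _ _ i
      by_cases hj : j = q
      · subst hj
        simp [hp.2, hq, hG]
      · simp [hj]
  convert key (Finset.univ.erase p) (by simp) using 1
  funext i j
  by_cases hj : j = p
  · subst hj
    simp [hxz]
  · simp [hj]

/-- Finitely many distinct points are separated by a linear form with leading coefficient one. -/
theorem exists_separating_form {d N : ℕ} (p : Fin d) (x : Fin N → (Fin d → ℝ))
    (hx : Function.Injective x) :
    ∃ a : Fin d → ℝ, a p = 0 ∧ Function.Injective fun i => x i p + a ⬝ᵥ x i := by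
  let f : Option {ij : Fin N × Fin N // ij.1 ≠ ij.2} → Module.Dual ℝ (Fin d → ℝ) := fun o =>
    o.elim (LinearMap.proj p) fun ij => dotProductBilin ℝ ℝ (x ij.1.1 - x ij.1.2)
  obtain ⟨c, hc⟩ := Module.Dual.exists_forall_ne_zero_of_forall_exists f (by
    rintro (_ | ⟨⟨i, j⟩, hij⟩)
    · exact ⟨Pi.single p 1, by simp [f]⟩
    · exact ⟨x i - x j, fun h => hx.ne hij (sub_eq_zero.1 (dotProduct_self_eq_zero.1 h))⟩)
  have hcp : c p ≠ 0 := hc none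
  refine ⟨(c p)⁻¹ • c - Pi.single p 1, by simp [hcp], fun i j hij => ?_⟩
  by_contra hne
  refine hc (some ⟨(i, j), hne⟩) ?_
  change (x i - x j) ⬝ᵥ c = 0
  simp only [sub_dotProduct, smul_dotProduct, single_dotProduct, one_mul, smul_eq_mul,
    add_sub_cancel] at hij
  rw [dotProduct_comm, dotProduct_sub, sub_eq_zero]
  exact mul_left_cancel₀ (inv_ne_zero hcp) hij

/-- Continuous-time ResNets with a non-affine Lipschitz activation possess the exact UIP. -/
theorem resnet_exact_uip {d : ℕ} (hd : 2 ≤ d) (σ : ℝ → ℝ)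
    (hLip : ∃ L : NNReal, LipschitzWith L σ)
    (hNonAffine : ¬ ∃ (a c : ℝ), ∀ x : ℝ, σ x = a * x + c) :
    ExactUIP (ResNetFamily d σ) := by
  intro N x y hx hy
  change Reach _ x y
  let p : Fin d := ⟨0, by omega⟩
  let q : Fin d := ⟨1, by omega⟩
  have hqp : q ≠ p := by simp [p, q]
  obtain ⟨a, ha, hax⟩ := exists_separating_form p x hx
  obtain ⟨c, hc, hcy⟩ := exists_separating_form p y hy
  let x₁ : Fin N → (Fin d → ℝ) := fun i => x i + (a ⬝ᵥ x i) • Pi.single p 1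
  let y₁ : Fin N → (Fin d → ℝ) := fun i => y i + (c ⬝ᵥ y i) • Pi.single p 1
  let x₂ : Fin N → (Fin d → ℝ) := fun i => Function.update (x₁ i) q (i : ℕ)
  let x₃ : Fin N → (Fin d → ℝ) := fun i => Function.update (x₂ i) p (y₁ i p)
  have h₁ : Reach (ResNetFamily d σ) x x₁ :=
    reach_shear hd hLip hNonAffine a (Pi.single p 1) (by simp [ha]) id x
  have h₂ : Reach (ResNetFamily d σ) x₁ x₂ :=
    reach_of_coord_injective hd hLip hNonAffine p _ _ (by simpa [x₁] using hax)
      (fun i => by simp [x₂, hqp.symm])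
  have h₃ : Reach (ResNetFamily d σ) x₂ x₃ :=
    reach_of_coord_injective hd hLip hNonAffine q _ _
      (fun i j h => by simpa [x₂, Fin.ext_iff] using h) (fun i => by simp [x₃, hqp])
  have h₄ : Reach (ResNetFamily d σ) x₃ y₁ :=
    reach_of_coord_injective hd hLip hNonAffine p _ _ (by simpa [x₃, y₁] using hcy)
      (fun i => by simp [x₃])
  have h₅ : Reach (ResNetFamily d σ) y₁ y := by
    convert reach_shear hd hLip hNonAffine c (-Pi.single p 1) (by simp [hc]) id y₁ using 2 with i
    simp [y₁, dotProduct_add, hc]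
  exact (((h₁.trans h₂).trans h₃).trans h₄).trans h₅
end

section
/- Consider the two-dimensional control system ẋ₁ = −θ₁ − 2θ₃ x₁² x₂, ẋ₂ = θ₂ + 2θ₃ x₁ x₂², with control parameter θ = (θ₁, θ₂, θ₃) ∈ ℝ³. For every N, all pairwise distinct points x^{(1)}, …, x^{(N)} ∈ ℝ² and all pairwise distinct points y^{(1)}, …, y^{(N)} ∈ ℝ², there exist T > 0, a piecewise constant control θ : [0,T] → ℝ³, and curves γ_1, …, γ_N : [0,T] → ℝ², each continuous and solving the system with control θ(t) (i.e., γ̇_i(t) = (−θ₁(t) − 2θ₃(t) γ_{i,1}(t)² γ_{i,2}(t), θ₂(t) + 2θ₃(t) γ_{i,1}(t) γ_{i,2}(t)²) at every non-switching time t), such that γ_i(0) = x^{(i)} and γ_i(T) = y^{(i)} for every i. In other words, the system possesses the exact universal interpolation property. -/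
open Set Filter Topology

/-- The controlled vector field. -/
def ctrlField (θ : ℝ × ℝ × ℝ) (z : ℝ × ℝ) : ℝ × ℝ :=
  (-θ.1 - 2 * θ.2.2 * z.1 ^ 2 * z.2, θ.2.1 + 2 * θ.2.2 * z.1 * z.2 ^ 2)

/-- A constant control steers the ensemble `x` to the ensemble `y` in unit time. -/
def ConstSteers {ι : Type*} (x y : ι → ℝ × ℝ) : Prop :=
  ∃ (θ : ℝ × ℝ × ℝ) (γ : ι → ℝ → ℝ × ℝ), ∀ i, γ i 0 = x i ∧ γ i 1 = y i ∧
    ∀ t, HasDerivAt (γ i) (ctrlField θ (γ i t)) t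

/-- Finitely many constant controls, applied successively, steer `x` to `y`. -/
def Steers {ι : Type*} (x y : ι → ℝ × ℝ) : Prop := Relation.ReflTransGen ConstSteers x y

section
variable {ι : Type*}

theorem ConstSteers.symm {x y : ι → ℝ × ℝ} (h : ConstSteers x y) : ConstSteers y x := by
  obtain ⟨θ, γ, h⟩ := h
  refine ⟨-θ, fun i t => γ i (1 - t), fun i => ⟨by simp [(h i).2.1], by simp [(h i).1], ?_⟩⟩
  intro t
  have h1 : HasDerivAt (fun s : ℝ => 1 - s) (-1) t := by
    simpa using (hasDerivAt_id t).const_sub 1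
  refine (((h i).2.2 (1 - t)).scomp t h1).congr_deriv ?_
  ext <;> simp [ctrlField] <;> ring

theorem Steers.symm {x y : ι → ℝ × ℝ} (h : Steers x y) : Steers y x :=
  by
  have : Std.Symm (ConstSteers (ι := ι)) := ⟨fun _ _ => ConstSteers.symm⟩
  exact Relation.ReflTransGen.stdSymm.symm _ _ h

theorem Steers.trans {x y z : ι → ℝ × ℝ} (h : Steers x y) (h' : Steers y z) : Steers x z :=
  Relation.ReflTransGen.trans h h'

theorem constSteers_translate (x : ι → ℝ × ℝ) (c : ℝ × ℝ) :
    ConstSteers x (fun i => x i + c) := by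
  refine ⟨(-c.1, c.2, 0), fun i t => x i + t • c, fun i => ⟨by simp, by simp, fun t => ?_⟩⟩
  refine (((hasDerivAt_id t).smul_const c).const_add (x i)).congr_deriv ?_
  ext <;> simp [ctrlField]

theorem constSteers_shear (x : ι → ℝ × ℝ) (s : ℝ) :
    ConstSteers x (fun i => ((x i).1 * Real.exp (-s * ((x i).1 * (x i).2)),
      (x i).2 * Real.exp (s * ((x i).1 * (x i).2)))) := by
  refine ⟨(0, 0, s / 2), fun i t => ((x i).1 * Real.exp (t * (-s * ((x i).1 * (x i).2))),
      (x i).2 * Real.exp (t * (s * ((x i).1 * (x i).2)))),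
    fun i => ⟨by simp, by simp, fun t => ?_⟩⟩
  have h (c : ℝ) : HasDerivAt (fun t => Real.exp (t * c)) (Real.exp (t * c) * c) t := by
    simpa using ((hasDerivAt_id t).mul_const c).exp
  refine (((h _).const_mul _).prodMk ((h _).const_mul _)).congr_deriv ?_
  have e : Real.exp (t * (-s * ((x i).1 * (x i).2))) * Real.exp (t * (s * ((x i).1 * (x i).2)))
      = 1 := by
    rw [← Real.exp_add]; simp
  simp only [ctrlField, Prod.mk.injEq]
  constructor
  · linear_combination (s * (x i).1 ^ 2 * (x i).2 *
      Real.exp (t * (-s * ((x i).1 * (x i).2)))) * e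
  · linear_combination (-s * (x i).1 * (x i).2 ^ 2 *
      Real.exp (t * (s * ((x i).1 * (x i).2)))) * e

/-- The translation by `(b, 0)` conjugated by the time-one flow of `(0, 0, s / 2)`. -/
noncomputable def conjShift (s : ℝ) (w : ℝ × (ι → ℝ × ℝ)) (i : ι) : ℝ × ℝ :=
  (((w.2 i).1 + w.1 * Real.exp (s * ((w.2 i).1 * (w.2 i).2))) *
      Real.exp (s * (w.1 * (w.2 i).2 * Real.exp (s * ((w.2 i).1 * (w.2 i).2)))),
    (w.2 i).2 * Real.exp (-s * (w.1 * (w.2 i).2 * Real.exp (s * ((w.2 i).1 * (w.2 i).2)))))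

theorem steers_conjShift (s b : ℝ) (x : ι → ℝ × ℝ) : Steers x (conjShift s (b, x)) := by
  refine ((Relation.ReflTransGen.single (constSteers_shear x s)).tail
    (constSteers_translate _ (b, 0))).tail ?_
  convert constSteers_shear _ (-s) using 1
  funext i
  have e : Real.exp (-s * ((x i).1 * (x i).2)) * Real.exp (s * ((x i).1 * (x i).2)) = 1 := by
    rw [← Real.exp_add]; simp
  have e' : ((x i).1 * Real.exp (-s * ((x i).1 * (x i).2)) + b) *
      ((x i).2 * Real.exp (s * ((x i).1 * (x i).2))) = (x i).1 * (x i).2 +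
        b * (x i).2 * Real.exp (s * ((x i).1 * (x i).2)) := by
    linear_combination (x i).1 * (x i).2 * e
  simp only [conjShift, Prod.mk_add_mk, add_zero, neg_neg, e', Prod.mk.injEq]
  rw [mul_add, mul_add, Real.exp_add, Real.exp_add]
  constructor
  · linear_combination (-(x i).1 * Real.exp (s * (b * (x i).2 *
      Real.exp (s * ((x i).1 * (x i).2))))) * e
  · linear_combination (-(x i).2 * Real.exp (-s * (b * (x i).2 *
      Real.exp (s * ((x i).1 * (x i).2))))) * e

/-- The velocity of `conjShift s (b, x)` at `b = 0`. -/
noncomputable def conjShiftVelocity (s : ℝ) (x : ι → ℝ × ℝ) (i : ι) : ℝ × ℝ :=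
  (Real.exp (s * ((x i).1 * (x i).2)) * (1 + s * ((x i).1 * (x i).2)),
    -s * (x i).2 ^ 2 * Real.exp (s * ((x i).1 * (x i).2)))

theorem conjShift_zero (s : ℝ) (x : ι → ℝ × ℝ) : conjShift s (0, x) = x := by
  funext i; simp [conjShift]

theorem contDiff_conjShift [Fintype ι] (s : ℝ) : ContDiff ℝ 1 (conjShift (ι := ι) s) := by
  unfold conjShift
  fun_prop

theorem hasDerivAt_conjShift [Fintype ι] (s : ℝ) (x : ι → ℝ × ℝ) :
    HasDerivAt (fun b => conjShift s (b, x)) (conjShiftVelocity s x) 0 := by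
  rw [hasDerivAt_pi]
  intro i
  have h (c d : ℝ) : HasDerivAt (fun b => Real.exp (c * (b * d))) (c * d) 0 := by
    simpa using (((hasDerivAt_id (0 : ℝ)).mul_const d).const_mul c).exp
  have h1 (c d : ℝ) : HasDerivAt (fun b => c + b * d) d 0 := by
    simpa using ((hasDerivAt_id (0 : ℝ)).mul_const d).const_add c
  simp only [conjShift, conjShiftVelocity, mul_assoc]
  refine (((h1 _ _).mul (h _ _)).prodMk ((h _ _).const_mul _)).congr_deriv ?_
  simp only [Prod.mk.injEq, zero_mul, mul_zero, Real.exp_zero]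
  constructor <;> ring
end

theorem hasStrictFDerivAt_of_eq_id_at_zero {E : Type*} [NormedAddCommGroup E] [NormedSpace ℝ E]
    {w : ℝ × E → E} (hw : ContDiff ℝ 1 w) (h0 : ∀ z, w (0, z) = z) {x v : E}
    (hv : HasDerivAt (fun b => w (b, x)) v 0) :
    HasStrictFDerivAt w ((ContinuousLinearMap.fst ℝ ℝ E).smulRight v +
      ContinuousLinearMap.snd ℝ ℝ E) (0, x) := by
  have hs : HasStrictFDerivAt w (fderiv ℝ w (0, x)) (0, x) :=
    hw.contDiffAt.hasStrictFDerivAt one_ne_zero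
  have hf := hs.hasFDerivAt
  convert hs using 1
  have hb : HasFDerivAt (fun b : ℝ => (b, x)) (ContinuousLinearMap.inl ℝ ℝ E) 0 :=
    hasFDerivAt_prodMk_left 0 x
  have hz : HasFDerivAt (fun z : E => ((0 : ℝ), z)) (ContinuousLinearMap.inr ℝ ℝ E) x :=
    hasFDerivAt_prodMk_right 0 x
  have e1 := (hf.comp (0 : ℝ) hb).unique hv.hasFDerivAt
  have e2 := (hf.comp x hz).unique
    ((hasFDerivAt_id x).congr_of_eventuallyEq (Eventually.of_forall h0))
  ext z
  · simpa using congr($e1 1).symm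
  · simpa using congr($e2 z).symm

section
variable {ι : Type*} [Fintype ι]

theorem exists_hasStrictFDerivAt_steers {κ : Type*} [Fintype κ] (s : κ → ℝ) (x : ι → ℝ × ℝ)
    (S : Finset κ) : ∃ Φ : (κ → ℝ) → (ι → ℝ × ℝ), Φ 0 = x ∧ (∀ b, Steers x (Φ b)) ∧
      HasStrictFDerivAt Φ (∑ k ∈ S, (ContinuousLinearMap.proj (R := ℝ) (φ := fun _ => ℝ) k).smulRight
        (conjShiftVelocity (s k) x)) 0 := by
  classical
  induction S using Finset.induction_on with
  | empty => exact ⟨fun _ => x, rfl, fun _ => .refl, by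
      rw [Finset.sum_empty]
      exact hasStrictFDerivAt_const x (0 : κ → ℝ)⟩
  | insert k S hk ih =>
    obtain ⟨Φ, h0, hr, hd⟩ := ih
    refine ⟨fun b => conjShift (s k) (b k, Φ b), by simp [h0, conjShift_zero],
      fun b => (hr b).trans (steers_conjShift _ _ _), ?_⟩
    have hp : HasStrictFDerivAt (fun b : κ → ℝ => b k)
      (ContinuousLinearMap.proj (R := ℝ) (φ := fun _ => ℝ) k) 0 :=
      (ContinuousLinearMap.proj (R := ℝ) (φ := fun _ => ℝ) k).hasStrictFDerivAt
    have hw : HasStrictFDerivAt (conjShift (s k))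
        ((ContinuousLinearMap.fst ℝ ℝ (ι → ℝ × ℝ)).smulRight (conjShiftVelocity (s k) x) +
          ContinuousLinearMap.snd ℝ ℝ (ι → ℝ × ℝ)) ((0 : κ → ℝ) k, Φ 0) := by
      rw [h0]
      exact hasStrictFDerivAt_of_eq_id_at_zero (contDiff_conjShift _) (conjShift_zero _)
        (hasDerivAt_conjShift _ _)
    refine (hw.comp (0 : κ → ℝ) (hp.prodMk hd)).congr_fderiv ?_
    rw [Finset.sum_insert hk]
    rfl

/-- For pairwise distinct values of `x₁ x₂` and nonzero `x₂`, the velocities span. -/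
theorem span_conjShiftVelocity_eq_top {x : ι → ℝ × ℝ} (h2 : ∀ i, (x i).2 ≠ 0)
    (hp : Function.Injective fun i => (x i).1 * (x i).2) :
    Submodule.span ℝ (range fun k : ℕ => conjShiftVelocity (k : ℝ) x) = ⊤ := by
  classical
  set V := Submodule.span ℝ (range fun k : ℕ => conjShiftVelocity (k : ℝ) x)
  let u : ι → ℝ := fun i => Real.exp ((x i).1 * (x i).2)
  have hu : Function.Injective u := Real.exp_injective.comp hp
  have hu0 : ∀ i, u i ≠ 0 := fun i => (Real.exp_pos _).ne'
  have key : ∀ q : Polynomial ℝ, (fun i => (q.eval (u i) + (x i).1 * (x i).2 *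
      (u i * q.derivative.eval (u i)), -(x i).2 ^ 2 * (u i * q.derivative.eval (u i)))) ∈ V := by
    intro q
    induction q using Polynomial.induction_on' with
    | add p q hp hq =>
      convert V.add_mem hp hq using 1
      funext i
      simp only [Polynomial.eval_add, Polynomial.derivative_add, Pi.add_apply, Prod.mk_add_mk,
        Prod.mk.injEq]
      constructor <;> ring
    | monomial n a =>
      convert V.smul_mem a (Submodule.subset_span (mem_range_self n)) using 1
      funext i
      have e : Real.exp (n * ((x i).1 * (x i).2)) = u i ^ n := Real.exp_nat_mul _ _
      have e2 : u i * (n * u i ^ (n - 1)) = n * u i ^ n := by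
        cases n with
        | zero => simp
        | succ n => simp [pow_succ]; ring
      simp only [Polynomial.eval_monomial, Polynomial.derivative_monomial, Pi.smul_apply,
        conjShiftVelocity, e, Prod.smul_mk, smul_eq_mul, Prod.mk.injEq]
      constructor
      · linear_combination (x i).1 * (x i).2 * a * e2
      · linear_combination -(x i).2 ^ 2 * a * e2
  have single : ∀ i (c : ℝ × ℝ), Pi.single i c ∈ V := by
    intro i c
    let P : Polynomial ℝ := ∏ j ∈ Finset.univ.erase i,
      (Polynomial.X - Polynomial.C (u j)) ^ 2
    have hPi : P.eval (u i) ≠ 0 := by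
      simp only [P, Polynomial.eval_prod, Finset.prod_ne_zero_iff]
      intro j hj
      have : u i ≠ u j := hu.ne (Finset.ne_of_mem_erase hj).symm
      simp [sub_eq_zero, this]
    have hPj : ∀ j, j ≠ i → P.eval (u j) = 0 ∧ P.derivative.eval (u j) = 0 := by
      intro j hj
      obtain ⟨Q, hQ⟩ : (Polynomial.X - Polynomial.C (u j)) ^ 2 ∣ P :=
        Finset.dvd_prod_of_mem (fun j => (Polynomial.X - Polynomial.C (u j)) ^ 2) (by simp [hj])
      rw [hQ]
      simp [Polynomial.derivative_mul, Polynomial.derivative_pow]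
    -- Hermite interpolation at `u i` with prescribed value and derivative
    have herm : ∀ α β : ℝ, ∃ q : Polynomial ℝ, q.eval (u i) = α ∧ q.derivative.eval (u i) = β ∧
        ∀ j, j ≠ i → q.eval (u j) = 0 ∧ q.derivative.eval (u j) = 0 := by
      intro α β
      refine ⟨P * (Polynomial.C (α / P.eval (u i)) + Polynomial.C
        ((β - P.derivative.eval (u i) * (α / P.eval (u i))) / P.eval (u i)) *
          (Polynomial.X - Polynomial.C (u i))), ?_, ?_, ?_⟩
      · simp; field_simp
      · simp [Polynomial.derivative_mul]; field_simp; ring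
      · intro j hj
        simp [Polynomial.derivative_mul, hPj j hj]
    obtain ⟨q, h1, h3, h4⟩ := herm (c.1 + (x i).1 * (x i).2 * (c.2 / (x i).2 ^ 2))
      (-c.2 / (x i).2 ^ 2 / u i)
    convert key q using 1
    funext j
    by_cases hj : j = i
    · subst hj
      have := h2 j
      have := hu0 j
      rw [h1, h3, Pi.single_eq_same]
      ext <;> simp only <;> field_simp
      ring
    · simp [hj, h4 j hj, Prod.zero_eq_mk]
  rw [eq_top_iff]
  rintro z -
  rw [← Finset.univ_sum_single z]
  exact V.sum_mem fun i _ => single i _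

theorem eventually_steers_of_generic {x : ι → ℝ × ℝ} (h2 : ∀ i, (x i).2 ≠ 0)
    (hp : Function.Injective fun i => (x i).1 * (x i).2) : ∀ᶠ z in 𝓝 x, Steers x z := by
  have htop := span_conjShiftVelocity_eq_top h2 hp
  obtain ⟨S, hS, hspan⟩ := (Submodule.fg_span_iff_fg_span_finset_subset _).1
    (htop ▸ Module.Finite.fg_top)
  choose k hk using hS
  obtain ⟨Φ, h0, hr, hd⟩ := exists_hasStrictFDerivAt_steers
    (fun v : S => (k v.2 : ℝ)) x Finset.univ
  have hsurj := hd.map_nhds_eq_of_surj (by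
    rw [LinearMap.range_eq_top]
    intro z
    have hz : z ∈ Submodule.span ℝ (range ((↑) : S → ι → ℝ × ℝ)) := by
      have hr : range ((↑) : S → ι → ℝ × ℝ) = ↑S := Subtype.range_coe
      rw [hr, ← hspan, htop]
      trivial
    obtain ⟨c, hc⟩ := (Submodule.mem_span_range_iff_exists_fun ℝ).1 hz
    refine ⟨c, ?_⟩
    rw [← hc]
    simp [hk])
  rw [h0] at hsurj
  rw [← hsurj, eventually_map]
  exact Eventually.of_forall hr

theorem exists_generic_translate {x : ι → ℝ × ℝ} (hx : Function.Injective x) :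
    ∃ c : ℝ × ℝ, (∀ i, (x i + c).2 ≠ 0) ∧
      Function.Injective fun i => (x i + c).1 * (x i + c).2 := by
  obtain ⟨b, hb⟩ := (finite_range fun i => -(x i).2).exists_notMem
  have hb' : ∀ i, (x i).2 + b ≠ 0 := fun i h => hb ⟨i, by linarith⟩
  obtain ⟨a, ha⟩ := (finite_range fun ij : ι × ι =>
    -((x ij.1).1 * ((x ij.1).2 + b) - (x ij.2).1 * ((x ij.2).2 + b)) /
      ((x ij.1).2 - (x ij.2).2)).exists_notMem
  refine ⟨(a, b), hb', fun i j hij => hx ?_⟩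
  simp only [Prod.fst_add, Prod.snd_add] at hij
  by_cases h : (x i).2 = (x j).2
  · rw [h] at hij
    exact Prod.ext (by simpa using mul_right_cancel₀ (hb' j) hij) h
  · refine absurd ⟨(i, j), ?_⟩ ha
    have := sub_ne_zero.2 h
    simp only
    field_simp
    linarith

theorem eventually_steers {x : ι → ℝ × ℝ} (hx : Function.Injective x) :
    ∀ᶠ z in 𝓝 x, Steers x z := by
  obtain ⟨c, h2, hp⟩ := exists_generic_translate hx
  have hc : Tendsto (fun z : ι → ℝ × ℝ => fun i => z i + c) (𝓝 x) (𝓝 fun i => x i + c) :=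
    Continuous.tendsto (by fun_prop) x
  filter_upwards [hc.eventually (eventually_steers_of_generic h2 hp)] with z hz
  have ht (w : ι → ℝ × ℝ) : Steers w (fun i => w i + c) := .single (constSteers_translate w c)
  exact ((ht x).trans hz).trans (ht z).symm

theorem steers_update [DecidableEq ι] {x : ι → ℝ × ℝ} (hx : Function.Injective x) (i : ι)
    {q : ℝ × ℝ} (hq : ∀ j, j ≠ i → q ≠ x j) : Steers x (Function.update x i q) := by
  have hconn : IsPreconnected (x '' {i}ᶜ)ᶜ :=
    ((toFinite (x '' {i}ᶜ)).countable.isPathConnected_compl_of_one_lt_rank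
      (by simp; norm_num)).isConnected.isPreconnected
  have hinj : ∀ q ∈ (x '' {i}ᶜ)ᶜ, Function.Injective (Function.update x i q) := by
    intro q hq a b hab
    by_cases ha : a = i <;> by_cases hb : b = i
    · rw [ha, hb]
    · subst ha
      simp [hb] at hab
      exact absurd ⟨b, hb, hab.symm⟩ hq
    · subst hb
      simp [ha] at hab
      exact absurd ⟨a, ha, hab⟩ hq
    · simp [ha, hb] at hab
      exact hx hab
  have := hconn.induction₂
    (fun p q => Steers (Function.update x i p) (Function.update x i q)) ?_
    (fun _ _ _ _ _ _ => Steers.trans) (fun _ _ _ _ => Steers.symm)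
    (x := x i) (y := q) ?_ ?_
  · simpa using this
  · intro p hp
    refine Filter.Eventually.filter_mono nhdsWithin_le_nhds ?_
    have : Tendsto (fun q => Function.update x i q) (𝓝 p) (𝓝 (Function.update x i p)) :=
      Continuous.tendsto (by fun_prop) p
    exact this.eventually (eventually_steers (hinj p hp))
  · rintro ⟨j, hj, h⟩
    exact hj (hx h)
  · rintro ⟨j, hj, h⟩
    exact hq j hj h.symm

theorem steers_of_disjoint {x z : ι → ℝ × ℝ} (hx : Function.Injective x)
    (hz : Function.Injective z) (hxz : ∀ i j, x i ≠ z j) : Steers x z := by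
  classical
  have h : ∀ S : Finset ι, Steers x (S.piecewise z x) := by
    intro S
    induction S using Finset.induction_on with
    | empty =>
      rw [Finset.piecewise_empty]
      exact Relation.ReflTransGen.refl
    | insert i S hi ih =>
      rw [Finset.piecewise_insert]
      refine ih.trans (steers_update ?_ i ?_)
      · intro a b hab
        by_cases ha : a ∈ S <;> by_cases hb : b ∈ S <;> simp [ha, hb] at hab
        · exact hz hab
        · exact absurd hab.symm (hxz _ _)
        · exact absurd hab (hxz _ _)
        · exact hx hab
      · intro j hj
        by_cases hjS : j ∈ S <;> simp [hjS]
        · exact hz.ne hj.symm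
        · exact (hxz _ _).symm
  simpa using h Finset.univ

theorem steers_of_injective {x y : ι → ℝ × ℝ} (hx : Function.Injective x)
    (hy : Function.Injective y) : Steers x y := by
  have hinf : (range x ∪ range y)ᶜ.Infinite :=
    ((finite_range x).union (finite_range y)).infinite_compl
  have := hinf.to_subtype
  obtain ⟨e⟩ : Nonempty (ι ↪ ↥(range x ∪ range y)ᶜ) :=
    ⟨(Fintype.equivFin ι).toEmbedding.trans
      (Fin.valEmbedding.trans (Infinite.natEmbedding _))⟩
  have he : Function.Injective fun i => (e i : ℝ × ℝ) :=
    Subtype.val_injective.comp e.injective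
  refine (steers_of_disjoint hx he fun i j h => (e j).2 (.inl ⟨i, h⟩)).trans
    (steers_of_disjoint hy he fun i j h => (e j).2 (.inr ⟨i, h⟩)).symm
end

section
variable {ι : Type*}

/-- A control constant on the unit intervals of `[0, n]` steers `x` to `y`. -/
def SteersIn (n : ℕ) (x y : ι → ℝ × ℝ) : Prop :=
  ∃ (θ : ℝ → ℝ × ℝ × ℝ) (γ : ι → ℝ → ℝ × ℝ),
    (∀ k < n, ∀ s ∈ Ico (k : ℝ) (k + 1), θ s = θ k) ∧
    ∀ i, Continuous (γ i) ∧ γ i 0 = x i ∧ γ i n = y i ∧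
      ∀ t ∈ Icc (0 : ℝ) n, (∀ k ≤ n, t ≠ k) → HasDerivAt (γ i) (ctrlField (θ t) (γ i t)) t

theorem SteersIn.succ {n : ℕ} {x y z : ι → ℝ × ℝ} (h : SteersIn n x y) (h' : ConstSteers y z) :
    SteersIn (n + 1) x z := by
  obtain ⟨θ, γ, hθ, hγ⟩ := h
  obtain ⟨ϑ, δ, hδ⟩ := h'
  refine ⟨fun s => if s < n then θ s else ϑ,
    fun i s => if s ≤ n then γ i s else δ i (s - n), ?_, fun i => ⟨?_, ?_, ?_, ?_⟩⟩
  · intro k hk s hs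
    rcases (Nat.lt_succ_iff.1 hk).lt_or_eq with hkn | rfl
    · have h1 : (k : ℝ) + 1 ≤ n := by exact_mod_cast hkn
      have h2 : (k : ℝ) < n := by linarith
      simp only [if_pos (hs.2.trans_le h1), if_pos h2, hθ k hkn s hs]
    · simp [hs.1.not_gt]
  · have hc : Continuous (δ i) :=
      continuous_iff_continuousAt.2 fun t => ((hδ i).2.2 t).continuousAt
    refine Continuous.if_le (hγ i).1 (by fun_prop) continuous_id continuous_const ?_
    rintro s rfl
    simp [(hδ i).1, (hγ i).2.2.1]
  · simp [(hγ i).2.1]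
  · simp [(hδ i).2.1]
  · intro t ht htk
    rcases (htk n n.le_succ).lt_or_gt with hlt | hgt
    · simp only [if_pos hlt, if_pos hlt.le]
      refine ((hγ i).2.2.2 t ⟨ht.1, hlt.le⟩ fun k hk => htk k (hk.trans n.le_succ)
        ).congr_of_eventuallyEq ?_
      filter_upwards [eventually_lt_nhds hlt] with s hs
      simp [hs.le]
    · simp only [if_neg hgt.not_gt, if_neg hgt.not_ge]
      refine (((hδ i).2.2 (t - n)).comp_sub_const t n).congr_of_eventuallyEq ?_
      filter_upwards [eventually_gt_nhds hgt] with s hs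
      simp [hs.not_ge]

theorem Steers.exists_steersIn {x y : ι → ℝ × ℝ} (h : Steers x y) : ∃ n, SteersIn n x y := by
  induction h with
  | refl =>
    refine ⟨0, fun _ => 0, fun i _ => x i, by simp, fun i => ⟨continuous_const, rfl, rfl, ?_⟩⟩
    intro t ht htk
    exact absurd (le_antisymm (by simpa using ht.2) ht.1) (by simpa using htk 0 le_rfl)
  | tail _ hbc ih =>
    obtain ⟨n, hn⟩ := ih
    exact ⟨n + 1, hn.succ hbc⟩
end

/-- Proposition 3.7: the two-dimensional control system
`ẋ₁ = −θ₁ − 2θ₃ x₁² x₂`, `ẋ₂ = θ₂ + 2θ₃ x₁ x₂²` possesses the exact universal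
interpolation property: any pairwise distinct ensemble of points can be steered
exactly to any pairwise distinct ensemble of targets by a single piecewise
constant control. -/
theorem volume_preserving_system_exact_uip
    (N : ℕ) (x y : Fin N → ℝ × ℝ)
    (hx : Function.Injective x) (hy : Function.Injective y) :
    ∃ T : ℝ, 0 < T ∧
    ∃ (θ : ℝ → ℝ × ℝ × ℝ) (m : ℕ) (τ : Fin (m + 1) → ℝ),
      StrictMono τ ∧ τ 0 = 0 ∧ τ (Fin.last m) = T ∧
      -- θ is constant between consecutive switching times
      (∀ j : Fin m, ∀ s ∈ Set.Ico (τ j.castSucc) (τ j.succ), θ s = θ (τ j.castSucc)) ∧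
      ∃ γ : Fin N → ℝ → ℝ × ℝ,
        ∀ i : Fin N,
          ContinuousOn (γ i) (Set.Icc 0 T) ∧
          γ i 0 = x i ∧ γ i T = y i ∧
          -- the ODE holds at every non-switching time
          ∀ t ∈ Set.Icc (0 : ℝ) T, (∀ j : Fin (m + 1), t ≠ τ j) →
            HasDerivAt (γ i)
              (-(θ t).1 - 2 * (θ t).2.2 * (γ i t).1 ^ 2 * (γ i t).2,
                (θ t).2.1 + 2 * (θ t).2.2 * (γ i t).1 * (γ i t).2 ^ 2) t := by
  obtain ⟨n, hn⟩ := (steers_of_injective hx hy).exists_steersIn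
  obtain ⟨θ, γ, hθ, hγ⟩ := hn.succ (by simpa using constSteers_translate y 0)
  refine ⟨(n + 1 : ℕ), by positivity, θ, n + 1, fun j => ((j : ℕ) : ℝ), ?_, by simp, by simp,
    ?_, γ, fun i => ?_⟩
  · intro a b hab
    exact Nat.cast_lt.2 hab
  · intro j s hs
    exact hθ j j.2 s (by simpa using hs)
  · obtain ⟨hc, h0, h1, hd⟩ := hγ i
    exact ⟨hc.continuousOn, h0, h1, fun t ht htj =>
      hd t ht fun k hk => htj ⟨k, Nat.lt_succ_of_le hk⟩⟩
end

section
/- For a smooth function f : ℝ² → ℝ, let v(f) denote the divergence-free vector field v(f) = (−∂f/∂x₂, ∂f/∂x₁) on ℝ². Let 𝓕 = { v(x₁), v(x₂), v(x₁² x₂²) } = { (0,1), (−1,0), (−2x₁²x₂, 2x₁x₂²) }. Then Lie(𝓕), the smallest linear subspace of smooth vector fields on ℝ² containing 𝓕 and closed under the Lie bracket, equals v(ℝ[x₁,x₂]) = { v(p) : p a real polynomial in x₁, x₂ }. -/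
/-- The Lie bracket of vector fields on `ℝ²`: `[X, Y](x) = DY(x)·X(x) − DX(x)·Y(x)`. -/
noncomputable def lieBracketVF (X Y : (ℝ × ℝ) → (ℝ × ℝ)) : (ℝ × ℝ) → (ℝ × ℝ) :=
  fun x => fderiv ℝ Y x (X x) - fderiv ℝ X x (Y x)

/-- `v(f) = (−∂f/∂x₂, ∂f/∂x₁)`, the divergence-free field associated to `f`. -/
noncomputable def vof (f : ℝ × ℝ → ℝ) : (ℝ × ℝ) → (ℝ × ℝ) :=
  fun x => (-(fderiv ℝ f x (0, 1)), fderiv ℝ f x (1, 0))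

/-- Membership in the smallest `ℝ`-linear subspace of vector fields containing `F`
and closed under the Lie bracket. -/
inductive InLie (F : Set ((ℝ × ℝ) → (ℝ × ℝ))) : ((ℝ × ℝ) → (ℝ × ℝ)) → Prop
  | base {X} : X ∈ F → InLie F X
  | zero : InLie F 0
  | add {X Y} : InLie F X → InLie F Y → InLie F (X + Y)
  | smul (c : ℝ) {X} : InLie F X → InLie F (c • X)
  | bracket {X Y} : InLie F X → InLie F Y → InLie F (lieBracketVF X Y)

open MvPolynomial

noncomputable section

/-- The polynomial function on `ℝ²` given by `p`. -/
def polyFun (p : MvPolynomial (Fin 2) ℝ) : ℝ × ℝ → ℝ :=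
  fun x => MvPolynomial.eval ![x.1, x.2] p

/-- The Poisson bracket of two polynomials in two variables. -/
def poissonBracket (p q : MvPolynomial (Fin 2) ℝ) : MvPolynomial (Fin 2) ℝ :=
  pderiv 0 p * pderiv 1 q - pderiv 1 p * pderiv 0 q

lemma hasFDerivAt_polyFun (p : MvPolynomial (Fin 2) ℝ) (x : ℝ × ℝ) :
    HasFDerivAt (polyFun p)
      (polyFun (pderiv 0 p) x • ContinuousLinearMap.fst ℝ ℝ ℝ +
        polyFun (pderiv 1 p) x • ContinuousLinearMap.snd ℝ ℝ ℝ) x := by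
  induction p using MvPolynomial.induction_on with
  | C a =>
    have h : polyFun (C a) = fun _ => a := by funext y; simp [polyFun]
    rw [h]
    exact (hasFDerivAt_const a x).congr_fderiv (by simp [polyFun])
  | add p q hp hq =>
    have h : polyFun (p + q) = polyFun p + polyFun q := by funext y; simp [polyFun]
    rw [h]
    refine (hp.add hq).congr_fderiv ?_
    ext <;> simp [polyFun]
  | mul_X p i hp =>
    fin_cases i
    · have h : polyFun (p * X 0) = polyFun p * Prod.fst := by funext y; simp [polyFun]
      change HasFDerivAt (polyFun (p * X 0)) _ x
      rw [h]
      refine (hp.mul hasFDerivAt_fst).congr_fderiv ?_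
      ext <;> simp [polyFun]
    · have h : polyFun (p * X 1) = polyFun p * Prod.snd := by funext y; simp [polyFun]
      change HasFDerivAt (polyFun (p * X 1)) _ x
      rw [h]
      refine (hp.mul hasFDerivAt_snd).congr_fderiv ?_
      ext <;> simp [polyFun]

lemma vof_polyFun (p : MvPolynomial (Fin 2) ℝ) :
    vof (polyFun p) = fun x => (-polyFun (pderiv 1 p) x, polyFun (pderiv 0 p) x) := by
  ext x <;> simp [vof, (hasFDerivAt_polyFun p x).fderiv]

lemma pderiv_one_pderiv_zero (p : MvPolynomial (Fin 2) ℝ) :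
    pderiv 1 (pderiv 0 p) = pderiv 0 (pderiv 1 p) := by
  induction p using MvPolynomial.induction_on with
  | C a => simp
  | add p q hp hq => simp [hp, hq]
  | mul_X p i hp => fin_cases i <;> simp [hp] <;> ring

lemma lieBracketVF_vof_polyFun (p q : MvPolynomial (Fin 2) ℝ) :
    lieBracketVF (vof (polyFun p)) (vof (polyFun q)) = vof (polyFun (poissonBracket p q)) := by
  have key (r : MvPolynomial (Fin 2) ℝ) (x : ℝ × ℝ) :=
    ((hasFDerivAt_polyFun (pderiv 1 r) x).neg.prodMk (hasFDerivAt_polyFun (pderiv 0 r) x)).fderiv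
  simp only [vof_polyFun]
  ext x
  all_goals
    simp only [lieBracketVF]
    erw [key p x, key q x]
    simp [poissonBracket, polyFun, pderiv_one_pderiv_zero]
    ring

/-- The generators `v(x₁)`, `v(x₂)`, `v(x₁²x₂²)`. -/
abbrev generators : Set ((ℝ × ℝ) → (ℝ × ℝ)) :=
  { vof (fun x => x.1), vof (fun x => x.2), vof (fun x => x.1 ^ 2 * x.2 ^ 2) }

lemma vof_polyFun_add (p q : MvPolynomial (Fin 2) ℝ) :
    vof (polyFun (p + q)) = vof (polyFun p) + vof (polyFun q) := by
  simp only [vof_polyFun]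
  ext x <;> simp [polyFun]
  ring

lemma vof_polyFun_smul (c : ℝ) (p : MvPolynomial (Fin 2) ℝ) :
    vof (polyFun (c • p)) = c • vof (polyFun p) := by
  simp only [vof_polyFun]
  ext x <;> simp [polyFun, smul_eval]

/-- The polynomials whose divergence-free field lies in the Lie algebra of the generators. -/
def hamiltonians : Submodule ℝ (MvPolynomial (Fin 2) ℝ) where
  carrier := { p | InLie generators (vof (polyFun p)) }
  zero_mem' := by
    have : vof (polyFun 0) = 0 := by simpa using vof_polyFun_smul 0 0
    simpa [this] using InLie.zero
  add_mem' {p q} hp hq := by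
    simpa only [Set.mem_ofPred_eq, vof_polyFun_add] using hp.add hq
  smul_mem' c p hp := by
    simpa only [Set.mem_ofPred_eq, vof_polyFun_smul] using hp.smul c

lemma poissonBracket_mem {p q : MvPolynomial (Fin 2) ℝ} (hp : p ∈ hamiltonians)
    (hq : q ∈ hamiltonians) : poissonBracket p q ∈ hamiltonians := by
  change InLie _ _
  rw [← lieBracketVF_vof_polyFun]
  exact InLie.bracket hp hq

lemma polyFun_X_zero : polyFun (X 0) = fun x => x.1 := by ext x; simp [polyFun]

lemma polyFun_X_one : polyFun (X 1) = fun x => x.2 := by ext x; simp [polyFun]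

lemma polyFun_X_sq_mul_X_sq :
    polyFun (X 0 ^ 2 * X 1 ^ 2) = fun x => x.1 ^ 2 * x.2 ^ 2 := by ext x; simp [polyFun]

lemma X_zero_mem : X 0 ∈ hamiltonians := by
  change InLie _ _
  exact InLie.base (by simp [polyFun_X_zero])

lemma X_one_mem : X 1 ∈ hamiltonians := by
  change InLie _ _
  exact InLie.base (by simp [polyFun_X_one])

lemma X_sq_mul_X_sq_mem : X 0 ^ 2 * X 1 ^ 2 ∈ hamiltonians := by
  change InLie _ _
  exact InLie.base (by simp [polyFun_X_sq_mul_X_sq])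

lemma mem_of_poissonBracket_eq_smul {p q r : MvPolynomial (Fin 2) ℝ} {c : ℝ} (hc : c ≠ 0)
    (hp : p ∈ hamiltonians) (hq : q ∈ hamiltonians) (h : poissonBracket p q = C c * r) :
    r ∈ hamiltonians := by
  have := poissonBracket_mem hp hq
  rw [h, ← smul_eq_C_mul] at this
  exact (hamiltonians.smul_mem_iff hc).1 this

lemma lower_left_mem {a b : ℕ} (h : X 0 ^ (a + 1) * X 1 ^ b ∈ hamiltonians) :
    X 0 ^ a * X 1 ^ b ∈ hamiltonians := by
  refine mem_of_poissonBracket_eq_smul (c := -(a + 1)) (neg_ne_zero.2 (by positivity)) X_one_mem h ?_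
  simp [poissonBracket, pderiv_X]
  ring

lemma lower_right_mem {a b : ℕ} (h : X 0 ^ a * X 1 ^ (b + 1) ∈ hamiltonians) :
    X 0 ^ a * X 1 ^ b ∈ hamiltonians := by
  refine mem_of_poissonBracket_eq_smul (c := b + 1) (by positivity) X_zero_mem h ?_
  simp [poissonBracket, pderiv_X]
  ring

lemma diagonal_mem (n : ℕ) : X 0 ^ (n + 1) * X 1 ^ (n + 1) ∈ hamiltonians := by
  induction n with
  | zero => exact lower_left_mem (lower_right_mem X_sq_mul_X_sq_mem)
  | succ n ih =>
    have h : X 0 ^ (n + 2) * X 1 ^ (n + 1) ∈ hamiltonians := by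
      refine mem_of_poissonBracket_eq_smul (c := n + 1) (by positivity)
        (lower_right_mem X_sq_mul_X_sq_mem) ih ?_
      simp [poissonBracket, pderiv_X]
      ring
    refine mem_of_poissonBracket_eq_smul (c := -(n + 3)) (neg_ne_zero.2 (by positivity)) (lower_left_mem X_sq_mul_X_sq_mem) h ?_
    simp [poissonBracket, pderiv_X, map_ofNat C 3]
    ring

lemma X_pow_mul_X_pow_mem (a b : ℕ) : X 0 ^ a * X 1 ^ b ∈ hamiltonians := by
  have left (k a b : ℕ) (h : X 0 ^ (a + k) * X 1 ^ b ∈ hamiltonians) :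
      X 0 ^ a * X 1 ^ b ∈ hamiltonians := by
    induction k with
    | zero => exact h
    | succ k ih => exact ih (lower_left_mem h)
  have right (k a b : ℕ) (h : X 0 ^ a * X 1 ^ (b + k) ∈ hamiltonians) :
      X 0 ^ a * X 1 ^ b ∈ hamiltonians := by
    induction k with
    | zero => exact h
    | succ k ih => exact ih (lower_right_mem h)
  refine left (b + 1) a b (right (a + 1) _ b ?_)
  rw [show b + (a + 1) = a + (b + 1) by ring]
  exact diagonal_mem (a + b)

lemma mem_hamiltonians (p : MvPolynomial (Fin 2) ℝ) : p ∈ hamiltonians := by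
  induction p using MvPolynomial.induction_on' with
  | monomial u c =>
    rw [monomial_eq, ← smul_eq_C_mul, Finsupp.prod_fintype _ _ (by simp), Fin.prod_univ_two]
    exact hamiltonians.smul_mem c (X_pow_mul_X_pow_mem _ _)
  | add p q hp hq => exact hamiltonians.add_mem hp hq

lemma InLie.exists_polyFun {Y : (ℝ × ℝ) → (ℝ × ℝ)} (h : InLie generators Y) :
    ∃ p, Y = vof (polyFun p) := by
  induction h with
  | base h =>
    rcases h with rfl | rfl | rfl
    · exact ⟨X 0, by rw [polyFun_X_zero]⟩
    · exact ⟨X 1, by rw [polyFun_X_one]⟩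
    · exact ⟨X 0 ^ 2 * X 1 ^ 2, by rw [polyFun_X_sq_mul_X_sq]⟩
  | zero => exact ⟨0, by simpa using (vof_polyFun_smul 0 0).symm⟩
  | add _ _ hp hq =>
    obtain ⟨p, rfl⟩ := hp
    obtain ⟨q, rfl⟩ := hq
    exact ⟨p + q, (vof_polyFun_add p q).symm⟩
  | smul c _ hp =>
    obtain ⟨p, rfl⟩ := hp
    exact ⟨c • p, (vof_polyFun_smul c p).symm⟩
  | bracket _ _ hp hq =>
    obtain ⟨p, rfl⟩ := hp
    obtain ⟨q, rfl⟩ := hq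
    exact ⟨poissonBracket p q, lieBracketVF_vof_polyFun p q⟩

end

/-- Lemma 3.8: `Lie{v(x₁), v(x₂), v(x₁²x₂²)}` equals the set of all divergence-free
polynomial vector fields `v(p)`, `p ∈ ℝ[x₁, x₂]`. -/
theorem lie_closure_eq_divfree_polynomials :
    { X | InLie
        ({ vof (fun x => x.1), vof (fun x => x.2),
           vof (fun x => x.1 ^ 2 * x.2 ^ 2) } : Set ((ℝ × ℝ) → (ℝ × ℝ))) X } =
      { X | ∃ p : MvPolynomial (Fin 2) ℝ,
        X = vof (fun x => MvPolynomial.eval ![x.1, x.2] p) } := by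
  ext Y
  refine ⟨InLie.exists_polyFun, ?_⟩
  rintro ⟨p, rfl⟩
  exact mem_hamiltonians p
end
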